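/- arXiv:2003.12271 — 2 statements merged into one kernel-verified Lean document; each statement's English description precedes it below -/
import Mathlib

section
/- For every chain K in the poset E(P) one has T^e_K ⊆ V_{sgn(K)}. -/
open Classical

/-- An order filter (upper set) of a poset. -/
def IsOrderFilter {P : Type*} [PartialOrder P] (F : Set P) : Prop :=
  ∀ ⦃u v : P⦄, u ∈ F → u ≤ v → v ∈ F

/-- The support of an integer-valued map. -/
def zsupp {P : Type*} (f : P → ℤ) : Set P := {v | f v ≠ 0}

/-- Membership in `E(P)`. -/
def IsEF {P : Type*} [PartialOrder P] (f : P → ℤ) : Prop :=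
  (∀ v, f v = 1 ∨ f v = 0 ∨ f v = -1) ∧
  IsOrderFilter (zsupp f) ∧
  ∀ v ∈ zsupp f, ¬ Minimal (· ∈ zsupp f) v → f v = 1

/-- The strict relation `f > g` on `E(P)`. -/
def egt {P : Type*} [PartialOrder P] (f g : P → ℤ) : Prop :=
  zsupp g ⊂ zsupp f ∧
  (∀ v ∈ zsupp g, g v ≤ f v) ∧
  ∀ v ∈ zsupp g, Minimal (· ∈ zsupp f) v → f v = g v

/-- The relation `f ≥ g` on `E(P)`. -/
def ege {P : Type*} [PartialOrder P] (f g : P → ℤ) : Prop := f = g ∨ egt f g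

/-- A chain in the poset `E(P)`. -/
def IsEChain {P : Type*} [PartialOrder P] (K : Set (P → ℤ)) : Prop :=
  (∀ f ∈ K, IsEF f) ∧ IsChain ege K

/-- A maximal chain in the poset `E(P)`. -/
def IsMaxEChain {P : Type*} [PartialOrder P] (K : Set (P → ℤ)) : Prop :=
  IsEChain K ∧ ∀ L, IsEChain L → K ⊆ L → K = L

/-- The set of minimal elements of a subset. -/
def minSet {P : Type*} [PartialOrder P] (F : Set P) : Set P := {v | Minimal (· ∈ F) v}

/-- The signature of a chain in `E(P)`. -/
noncomputable def esgn {P : Type*} [PartialOrder P] (K : Set (P → ℤ)) (v : P) : ℤ :=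
  if h : ∃ f ∈ K, Minimal (· ∈ zsupp f) v then h.choose v else 0

/-- The enriched transfer map. -/
noncomputable def ePhi {P : Type*} [PartialOrder P] (f : P → ℤ) : P → ℝ :=
  fun v => if Minimal (· ∈ zsupp f) v then (f v : ℝ) else 0

/-- The simplex `T^e_K` attached to a chain `K` in `E(P)`. -/
noncomputable def Tsimp {P : Type*} [PartialOrder P] (K : Set (P → ℤ)) : Set (P → ℝ) :=
  convexHull ℝ (ePhi '' K)

/-- Indicator of the set of minimal elements of `F`. -/
noncomputable def chiMin {P : Type*} [PartialOrder P] (F : Set P) : P → ℝ :=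
  fun v => if Minimal (· ∈ F) v then 1 else 0

/-- The simplex `T_C` attached to a chain `C` of order filters. -/
noncomputable def TCsimp {P : Type*} [PartialOrder P] (C : Set (Set P)) : Set (P → ℝ) :=
  convexHull ℝ (chiMin '' C)

/-- The sign-change map `R_φ`. -/
def Rmap {P : Type*} (φ : P → ℤ) (g : P → ℝ) : P → ℝ :=
  fun v => if φ v = -1 then -g v else g v

/-- The orthant-type region `V_φ`. -/
def Vset {P : Type*} (φ : P → ℤ) : Set (P → ℝ) :=
  {g | ∀ v, (φ v = 1 → 0 ≤ g v) ∧ (φ v = 0 → g v = 0) ∧ (φ v = -1 → g v ≤ 0)}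

/-- The set `eA(P)` of `±1`-indicator vectors of antichains, inside `ℝ^P`. -/
def eAset (P : Type*) [PartialOrder P] : Set (P → ℝ) :=
  {g | (∀ v, g v = 1 ∨ g v = 0 ∨ g v = -1) ∧ IsAntichain (· ≤ ·) {v | g v ≠ 0}}

/-- The enriched chain polytope `eC(P)`. -/
noncomputable def eChainPolytope (P : Type*) [PartialOrder P] : Set (P → ℝ) :=
  convexHull ℝ (eAset P)

/-- The chain polytope `C(P)`. -/
noncomputable def chainPolytope (P : Type*) [PartialOrder P] : Set (P → ℝ) :=
  convexHull ℝ {g : P → ℝ | ∃ A : Set P, IsAntichain (· ≤ ·) A ∧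
    g = fun v => if v ∈ A then 1 else 0}

theorem IsEChain.apply_eq_of_minimal {P : Type*} [PartialOrder P] {K : Set (P → ℤ)}
    (hK : IsEChain K) {f g : P → ℤ} (hf : f ∈ K) (hg : g ∈ K) {v : P}
    (hfv : Minimal (· ∈ zsupp f) v) (hgv : Minimal (· ∈ zsupp g) v) : f v = g v := by
  by_cases hfg : f = g
  · rw [hfg]
  rcases hK.2 hf hg hfg with (h | h) | (h | h)
  · exact absurd h hfg
  · exact h.2.2 v hgv.prop hfv
  · exact absurd h.symm hfg
  · exact (h.2.2 v hfv.prop hgv).symm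

/-- The signature of a chain does not depend on the member used to compute it. -/
theorem IsEChain.esgn_eq {P : Type*} [PartialOrder P] {K : Set (P → ℤ)}
    (hK : IsEChain K) {f : P → ℤ} (hf : f ∈ K) {v : P} (hfv : Minimal (· ∈ zsupp f) v) :
    esgn K v = f v := by
  have h : ∃ g ∈ K, Minimal (· ∈ zsupp g) v := ⟨f, hf, hfv⟩
  rw [esgn, dif_pos h]
  exact hK.apply_eq_of_minimal h.choose_spec.1 hf h.choose_spec.2 hfv

theorem IsEChain.ePhi_mem_Vset {P : Type*} [PartialOrder P] {K : Set (P → ℤ)}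
    (hK : IsEChain K) {f : P → ℤ} (hf : f ∈ K) : ePhi f ∈ Vset (esgn K) := by
  intro v
  by_cases hfv : Minimal (· ∈ zsupp f) v
  · rw [ePhi, if_pos hfv, hK.esgn_eq hf hfv]
    refine ⟨fun h => ?_, fun h => ?_, fun h => ?_⟩ <;> simp [h]
  · simp [ePhi, hfv]

theorem convex_Vset {P : Type*} (φ : P → ℤ) : Convex ℝ (Vset φ) := by
  intro x hx y hy a b ha hb _ v
  obtain ⟨hx₁, hx₂, hx₃⟩ := hx v
  obtain ⟨hy₁, hy₂, hy₃⟩ := hy v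
  simp only [Pi.add_apply, Pi.smul_apply, smul_eq_mul]
  refine ⟨fun h => ?_, fun h => ?_, fun h => ?_⟩
  · exact add_nonneg (mul_nonneg ha (hx₁ h)) (mul_nonneg hb (hy₁ h))
  · simp [hx₂ h, hy₂ h]
  · exact add_nonpos (mul_nonpos_of_nonneg_of_nonpos ha (hx₃ h))
      (mul_nonpos_of_nonneg_of_nonpos hb (hy₃ h))

theorem stmt15 {P : Type*} [Fintype P] [PartialOrder P] {K : Set (P → ℤ)}
    (hK : IsEChain K) : Tsimp K ⊆ Vset (esgn K) := by
  apply convexHull_min _ (convex_Vset _)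
  rintro _ ⟨f, hf, rfl⟩
  exact hK.ePhi_mem_Vset hf
end

section
/- Let K be a maximal chain in the poset E(P), so that K has d + 1 elements where d = #P. Then the d + 1 points {Φᵉ(f) : f ∈ K} in ℝ^P are affinely independent, and their convex hull T^e_K has Euclidean volume (Lebesgue measure) equal to 1/d!; that is, T^e_K is a unimodular lattice simplex. -/
open Classical

/-- The map with support `F` taking the values of `s` on the minimal elements of `F` and the value
`1` on the rest of `F`. -/
noncomputable def signedFilter {P : Type*} [PartialOrder P] (s : P → ℤ) (F : Set P) : P → ℤ :=
  fun v => if v ∈ F then (if Minimal (· ∈ F) v then s v else 1) else 0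

section SignedFilter

variable {P : Type*} [PartialOrder P] {s : P → ℤ}

lemma zsupp_signedFilter (hs : ∀ v, s v = 1 ∨ s v = -1) (F : Set P) :
    zsupp (signedFilter s F) = F := by
  ext v
  have := hs v
  simp only [zsupp, signedFilter, Set.mem_ofPred_eq]
  split_ifs <;> grind

lemma isEF_signedFilter (hs : ∀ v, s v = 1 ∨ s v = -1) {F : Set P} (hF : IsOrderFilter F) :
    IsEF (signedFilter s F) := by
  refine ⟨fun v => ?_, ?_, ?_⟩
  · have := hs v
    unfold signedFilter
    split_ifs <;> grind
  · rwa [zsupp_signedFilter hs]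
  · rw [zsupp_signedFilter hs]
    intro v hv hmin
    simp [signedFilter, hv, hmin]

lemma egt_signedFilter (hs : ∀ v, s v = 1 ∨ s v = -1) {F G : Set P} (h : G ⊂ F) :
    egt (signedFilter s F) (signedFilter s G) := by
  have key : ∀ v ∈ G, Minimal (· ∈ F) v → signedFilter s F v = signedFilter s G v := by
    intro v hv hmin
    have hG : Minimal (· ∈ G) v := ⟨hv, fun w hw hle => hmin.2 (h.1 hw) hle⟩
    simp [signedFilter, hv, h.1 hv, hmin, hG]
  refine ⟨by rwa [zsupp_signedFilter hs, zsupp_signedFilter hs], ?_, ?_⟩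
  · rw [zsupp_signedFilter hs]
    intro v hv
    by_cases hmin : Minimal (· ∈ F) v
    · exact (key v hv hmin).ge
    · have := hs v
      simp only [signedFilter, hv, h.1 hv, hmin, if_true, if_false]
      split_ifs <;> grind
  · rwa [zsupp_signedFilter hs, zsupp_signedFilter hs]

lemma ege_signedFilter_or (hs : ∀ v, s v = 1 ∨ s v = -1) {F G : Set P} (h : F ⊆ G ∨ G ⊆ F) :
    ege (signedFilter s F) (signedFilter s G) ∨ ege (signedFilter s G) (signedFilter s F) := by
  by_cases hFG : F = G
  · exact Or.inl (Or.inl (by rw [hFG]))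
  · rcases h with h | h
    · exact Or.inr (Or.inr (egt_signedFilter hs (h.ssubset_of_ne hFG)))
    · exact Or.inl (Or.inr (egt_signedFilter hs (h.ssubset_of_ne (Ne.symm hFG))))

lemma ePhi_signedFilter (hs : ∀ v, s v = 1 ∨ s v = -1) (F : Set P) (v : P) :
    ePhi (signedFilter s F) v = if Minimal (· ∈ F) v then (s v : ℝ) else 0 := by
  unfold ePhi
  rw [zsupp_signedFilter hs]
  split_ifs with h
  · have hv : v ∈ F := h.1
    simp [signedFilter, hv, h]
  · rfl

end SignedFilter

section Chains

variable {P : Type*} [PartialOrder P]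

lemma IsEChain.exists_sign {K : Set (P → ℤ)} (hK : IsEChain K) :
    ∃ s : P → ℤ, (∀ v, s v = 1 ∨ s v = -1) ∧ ∀ f ∈ K, f = signedFilter s (zsupp f) := by
  have agree : ∀ f ∈ K, ∀ g ∈ K, ∀ v, Minimal (· ∈ zsupp f) v → Minimal (· ∈ zsupp g) v →
      f v = g v := by
    intro f hf g hg v hvf hvg
    by_cases hfg : f = g
    · rw [hfg]
    · rcases hK.2 hf hg hfg with (h | h) | (h | h)
      · rw [h]
      · exact h.2.2 v hvg.1 hvf
      · rw [h]
      · exact (h.2.2 v hvf.1 hvg).symm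
  let s : P → ℤ := fun v => if h : ∃ f ∈ K, Minimal (· ∈ zsupp f) v then h.choose v else 1
  refine ⟨s, fun v => ?_, fun f hf => funext fun v => ?_⟩
  · by_cases h : ∃ f ∈ K, Minimal (· ∈ zsupp f) v
    · have hsv : s v = h.choose v := dif_pos h
      obtain ⟨h₁, h₂⟩ := h.choose_spec
      have h₃ : h.choose v ≠ 0 := h₂.1
      rw [hsv]
      have := (hK.1 _ h₁).1 v
      tauto
    · exact Or.inl (dif_neg h)
  · by_cases hv : v ∈ zsupp f
    · by_cases hmin : Minimal (· ∈ zsupp f) v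
      · have h : ∃ f ∈ K, Minimal (· ∈ zsupp f) v := ⟨f, hf, hmin⟩
        have hsv : s v = h.choose v := dif_pos h
        simp only [signedFilter, hv, hmin, if_true, hsv]
        exact agree _ hf _ h.choose_spec.1 _ hmin h.choose_spec.2
      · simp only [signedFilter, hv, hmin, if_true, if_false]
        exact (hK.1 f hf).2.2 v hv hmin
    · simp only [signedFilter, hv, if_false]
      exact not_not.1 hv

lemma IsMaxEChain.signedFilter_mem {K : Set (P → ℤ)} (hK : IsMaxEChain K) {s : P → ℤ}
    (hs : ∀ v, s v = 1 ∨ s v = -1) (hsK : ∀ f ∈ K, f = signedFilter s (zsupp f)) {F : Set P}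
    (hF : IsOrderFilter F) (hcomp : ∀ f ∈ K, F ⊆ zsupp f ∨ zsupp f ⊆ F) :
    signedFilter s F ∈ K := by
  have hL : IsEChain (insert (signedFilter s F) K) := by
    refine ⟨?_, hK.1.2.insert fun g hg _ => ?_⟩
    · rintro g (rfl | hg)
      · exact isEF_signedFilter hs hF
      · exact hK.1.1 g hg
    · rw [hsK g hg]
      exact ege_signedFilter_or hs (hcomp g hg)
  rw [hK.2 _ hL (Set.subset_insert _ _)]
  exact Set.mem_insert _ _

/-- A maximal chain of order filters of a finite poset consists of `∅` and one filter `F v` for each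
element `v`, namely the smallest member of the chain containing `v`. -/
lemma exists_filter_enumeration [Finite P] {C : Set (Set P)} (hC : ∀ F ∈ C, IsOrderFilter F)
    (hchain : ∀ F ∈ C, ∀ G ∈ C, F ⊆ G ∨ G ⊆ F)
    (hmax : ∀ F, IsOrderFilter F → (∀ G ∈ C, F ⊆ G ∨ G ⊆ F) → F ∈ C) :
    ∃ F : P → Set P, Function.Injective F ∧ (∀ v, Minimal (· ∈ F v) v) ∧
      (∀ v w, w ∈ F v → F w ⊆ F v) ∧ C = insert ∅ (Set.range F) := by
  let F : P → Set P := fun v => {w | ∀ G ∈ C, v ∈ G → w ∈ G}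
  have hvF : ∀ v, v ∈ F v := fun v G _ hv => hv
  have hFle : ∀ v, ∀ G ∈ C, v ∈ G → F v ⊆ G := fun v G hG hv w hw => hw G hG hv
  have hFC : ∀ v, F v ∈ C := by
    intro v
    refine hmax _ (fun a b ha hab G hG hv => hC G hG (ha G hG hv) hab) fun G hG => ?_
    by_cases hv : v ∈ G
    · exact Or.inl (hFle v G hG hv)
    · refine Or.inr fun w hw H hH hvH => ?_
      rcases hchain G hG H hH with h | h
      · exact h hw
      · exact absurd (h hvH) hv
  have hmono : ∀ v w, w ∈ F v → F w ⊆ F v := fun v w hw => hFle w _ (hFC v) hw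
  have hle : ∀ v w, F v = F w → w ≤ v := by
    intro v w hvw
    by_contra hwv
    have hmem : {x ∈ F v | ¬ x ≤ v} ∈ C := by
      refine hmax _ (fun a b ha hab => ⟨hC _ (hFC v) ha.1 hab, fun hb => ha.2 (hab.trans hb)⟩) ?_
      intro G hG
      by_cases hv : v ∈ G
      · exact Or.inl fun x hx => hFle v G hG hv hx.1
      · refine Or.inr fun x hx => ⟨?_, fun hxv => hv (hC G hG hx hxv)⟩
        rcases hchain G hG _ (hFC v) with h | h
        · exact h hx
        · exact absurd (h (hvF v)) hv
    have hw : w ∈ {x ∈ F v | ¬ x ≤ v} := ⟨hvw ▸ hvF w, hwv⟩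
    have hv : v ∈ F w := hvw ▸ hvF v
    exact (hFle w _ hmem hw hv).2 le_rfl
  refine ⟨F, fun v w h => le_antisymm (hle w v h.symm) (hle v w h), fun v => ⟨hvF v, ?_⟩, hmono, ?_⟩
  · intro u hu huv
    have huF : v ∈ F u := hC _ (hFC u) (hvF u) huv
    exact hle u v ((hmono v u hu).antisymm (hmono u v huF))
  · ext G
    constructor
    · intro hG
      rcases G.eq_empty_or_nonempty with rfl | hne
      · exact Set.mem_insert _ _
      · obtain ⟨v, hvG, hv⟩ := Set.exists_max_image G (fun v => (F v).ncard) G.toFinite hne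
        refine Or.inr ⟨v, (hFle v G hG hvG).antisymm fun w hw => ?_⟩
        rcases hchain _ (hFC v) _ (hFC w) with h | h
        · rw [Set.eq_of_subset_of_ncard_le h (hv w hw)]
          exact hvF w
        · exact h (hvF w)
    · rintro (rfl | ⟨v, rfl⟩)
      · exact hmax _ (fun a b ha => absurd ha (Set.notMem_empty a))
          fun G _ => Or.inl (Set.empty_subset G)
      · exact hFC v

end Chains

lemma Matrix.det_eq_prod_diag_of_injective {m : Type*} [Fintype m] [DecidableEq m]
    {R : Type*} [CommRing R] (A : Matrix m m R) {b : m → ℕ} (hb : Function.Injective b)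
    (hA : ∀ i j, b i < b j → A i j = 0) : A.det = ∏ i, A i i := by
  let : LinearOrder m := LinearOrder.lift' b hb
  convert Matrix.det_of_isLowerTriangular A fun i j hij => hA i j hij

section Volume

open MeasureTheory

lemma volume_corner_simplex_fin (n : ℕ) (t : ℝ) (ht : 0 ≤ t) :
    volume {y : Fin n → ℝ | (∀ i, 0 ≤ y i) ∧ ∑ i, y i ≤ t} =
      ENNReal.ofReal (t ^ n / n.factorial) := by
  induction n generalizing t with
  | zero =>
    have : {y : Fin 0 → ℝ | (∀ i, 0 ≤ y i) ∧ ∑ i, y i ≤ t} = Set.univ := by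
      ext y; simp [ht]
    rw [this, volume_pi, Measure.pi_of_empty]
    simp
  | succ n ih =>
    set S : Set (Fin (n + 1) → ℝ) := {y | (∀ i, 0 ≤ y i) ∧ ∑ i, y i ≤ t} with hS
    have hSm : MeasurableSet S := by
      refine IsClosed.measurableSet ?_
      exact isClosed_Ici.inter (isClosed_le (f := fun y : Fin (n + 1) → ℝ => ∑ i, y i)
        (g := fun _ => t) (by fun_prop) continuous_const)
    have hmp := (volume_preserving_piFinSuccAbove (fun _ : Fin (n + 1) => ℝ) 0).symm
    rw [← hmp.measure_preimage hSm.nullMeasurableSet,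
      show (volume : Measure (ℝ × (Fin n → ℝ))) = volume.prod volume from rfl,
      Measure.prod_apply (hmp.measurable hSm)]
    have hslice : ∀ x : ℝ, volume (Prod.mk x ⁻¹'
        ((MeasurableEquiv.piFinSuccAbove (fun _ : Fin (n + 1) => ℝ) 0).symm ⁻¹' S)) =
        (Set.Icc 0 t).indicator (fun x => ENNReal.ofReal ((t - x) ^ n / n.factorial)) x := by
      intro x
      have hset : Prod.mk x ⁻¹'
          ((MeasurableEquiv.piFinSuccAbove (fun _ : Fin (n + 1) => ℝ) 0).symm ⁻¹' S) =
          {y : Fin n → ℝ | 0 ≤ x ∧ (∀ i, 0 ≤ y i) ∧ ∑ i, y i ≤ t - x} := by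
        ext y
        simp [hS, Fin.forall_fin_succ, Fin.sum_univ_succ, MeasurableEquiv.piFinSuccAbove,
          le_sub_iff_add_le', and_assoc]
      rw [hset]
      by_cases hx : x ∈ Set.Icc 0 t
      · rw [Set.indicator_of_mem hx, ← ih (t - x) (sub_nonneg.2 hx.2)]
        simp [hx.1]
      · rw [Set.indicator_of_notMem hx]
        convert measure_empty (μ := (volume : Measure (Fin n → ℝ)))
        ext y
        simp only [Set.mem_ofPred_eq, Set.mem_empty_iff_false, iff_false]
        rintro ⟨h₀, hy, hle⟩
        exact hx ⟨h₀, sub_nonneg.1 ((Finset.sum_nonneg fun i _ => hy i).trans hle)⟩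
    simp_rw [hslice]
    rw [lintegral_indicator measurableSet_Icc, ← ofReal_integral_eq_lintegral_ofReal]
    · congr 1
      rw [integral_Icc_eq_integral_Ioc, ← intervalIntegral.integral_of_le ht,
        intervalIntegral.integral_div,
        intervalIntegral.integral_comp_sub_left (fun x => x ^ n) t, integral_pow]
      simp [Nat.factorial_succ]
      field_simp
    · exact (Continuous.integrableOn_Icc (by fun_prop))
    · filter_upwards [ae_restrict_mem measurableSet_Icc] with x hx
      have := sub_nonneg.2 hx.2
      simp only [Pi.zero_apply]
      positivity

lemma volume_corner_simplex (ι : Type*) [Fintype ι] :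
    volume {y : ι → ℝ | (∀ i, 0 ≤ y i) ∧ ∑ i, y i ≤ 1} =
      ((Fintype.card ι).factorial : ENNReal)⁻¹ := by
  let e := (Fintype.equivFin ι).symm
  have hmp := volume_measurePreserving_piCongrLeft (fun _ : ι => ℝ) e
  rw [← hmp.measure_preimage_equiv]
  have hset : MeasurableEquiv.piCongrLeft (fun _ : ι => ℝ) e ⁻¹'
      {y : ι → ℝ | (∀ i, 0 ≤ y i) ∧ ∑ i, y i ≤ 1} =
      {y : Fin (Fintype.card ι) → ℝ | (∀ i, 0 ≤ y i) ∧ ∑ i, y i ≤ 1} := by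
    ext y
    simp only [Set.mem_preimage, Set.mem_ofPred_eq, ← e.forall_congr_right, ← e.sum_comp,
      MeasurableEquiv.coe_piCongrLeft, Equiv.piCongrLeft_apply_apply]
  rw [hset, volume_corner_simplex_fin _ _ zero_le_one, one_pow, one_div,
    ENNReal.ofReal_inv_of_pos (by positivity), ENNReal.ofReal_natCast]

lemma convexHull_insert_zero_range_single (ι : Type*) [Fintype ι] [DecidableEq ι] :
    convexHull ℝ (insert 0 (Set.range fun i : ι => (Pi.single i 1 : ι → ℝ))) =
      {y : ι → ℝ | (∀ i, 0 ≤ y i) ∧ ∑ i, y i ≤ 1} := by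
  apply Set.Subset.antisymm
  · refine convexHull_min ?_ ?_
    · rintro _ (rfl | ⟨i, rfl⟩)
      · simp
      · refine ⟨fun j => ?_, by simp⟩
        by_cases h : j = i
        · subst h; simp
        · simp [h]
    · rintro x ⟨hx, hx'⟩ y ⟨hy, hy'⟩ a b ha hb hab
      refine ⟨fun i => ?_, ?_⟩
      · exact add_nonneg (mul_nonneg ha (hx i)) (mul_nonneg hb (hy i))
      · simp only [Pi.add_apply, Pi.smul_apply, smul_eq_mul, Finset.sum_add_distrib,
          ← Finset.mul_sum]
        nlinarith
  · rintro y ⟨hy, hy'⟩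
    refine mem_convexHull_of_exists_fintype (ι := Option ι)
      (fun o => o.elim (1 - ∑ i, y i) y) (fun o => o.elim 0 fun i => Pi.single i 1) ?_ ?_ ?_ ?_
    · rintro (_ | i)
      · exact sub_nonneg.2 hy'
      · exact hy i
    · simp [Fintype.sum_option]
    · rintro (_ | i)
      · exact Set.mem_insert _ _
      · exact Or.inr ⟨i, rfl⟩
    · ext j
      simp [Fintype.sum_option, Pi.single_apply]

lemma volume_convexHull_insert_zero_rows {ι : Type*} [Fintype ι] [DecidableEq ι]
    (M : Matrix ι ι ℝ) :
    volume (convexHull ℝ (insert 0 (Set.range fun i => M i))) =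
      ENNReal.ofReal |M.det| * ((Fintype.card ι).factorial : ENNReal)⁻¹ := by
  have himage : insert 0 (Set.range fun i => M i) =
      Matrix.toLin' M.transpose '' insert 0 (Set.range fun i : ι => (Pi.single i 1 : ι → ℝ)) := by
    rw [Set.image_insert_eq, map_zero, ← Set.range_comp]
    congr 2
    ext i j
    simp
  rw [himage, ← LinearMap.image_convexHull, Measure.addHaar_image_linearMap,
    LinearMap.det_toLin', Matrix.det_transpose, convexHull_insert_zero_range_single,
    volume_corner_simplex]

end Volume

theorem stmt18 {P : Type*} [Fintype P] [PartialOrder P] {K : Set (P → ℤ)}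
    (hK : IsMaxEChain K) :
    AffineIndependent ℝ (fun f : K => ePhi (f : P → ℤ)) ∧
    MeasureTheory.volume (Tsimp K) = ((Fintype.card P).factorial : ENNReal)⁻¹ := by
  obtain ⟨s, hs, hsK⟩ := hK.1.exists_sign
  have hmem : ∀ F, IsOrderFilter F → (∀ f ∈ K, F ⊆ zsupp f ∨ zsupp f ⊆ F) →
      signedFilter s F ∈ K := fun F hF => hK.signedFilter_mem hs hsK hF
  have hchain : ∀ F ∈ zsupp '' K, ∀ G ∈ zsupp '' K, F ⊆ G ∨ G ⊆ F := by
    rintro _ ⟨f, hf, rfl⟩ _ ⟨g, hg, rfl⟩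
    by_cases hfg : f = g
    · exact Or.inl (by rw [hfg])
    · rcases hK.1.2 hf hg hfg with (h | h) | (h | h)
      · exact absurd h hfg
      · exact Or.inr h.1.1
      · exact absurd h.symm hfg
      · exact Or.inl h.1.1
  obtain ⟨F, hinj, hmin, hmono, hC⟩ := exists_filter_enumeration (C := zsupp '' K)
    (by rintro _ ⟨f, hf, rfl⟩; exact (hK.1.1 f hf).2.1) hchain
    (fun G hG h => ⟨_, hmem G hG fun f hf => h _ ⟨f, hf, rfl⟩, zsupp_signedFilter hs G⟩)
  have htotal : ∀ v w, F v ⊆ F w ∨ F w ⊆ F v := fun v w =>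
    hchain _ (hC ▸ Or.inr ⟨v, rfl⟩) _ (hC ▸ Or.inr ⟨w, rfl⟩)
  have hKeq : K = insert (signedFilter s ∅) (Set.range fun v => signedFilter s (F v)) := by
    have : K = signedFilter s '' (zsupp '' K) := by
      rw [Set.image_image]
      exact ((Set.image_congr fun f hf => (hsK f hf).symm).trans (Set.image_id K)).symm
    rw [this, hC, Set.image_insert_eq, ← Set.range_comp]
    rfl
  have hzero : ePhi (signedFilter s ∅) = 0 := by
    ext v
    rw [ePhi_signedFilter hs, if_neg fun h => Set.notMem_empty v h.1]
    rfl
  let M : Matrix P P ℝ := fun v => ePhi (signedFilter s (F v))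
  have hdet : M.det = ∏ v, (s v : ℝ) := by
    have hb : Function.Injective fun v => (F v).ncard := by
      intro v w h
      rcases htotal v w with hvw | hvw
      · exact hinj (Set.eq_of_subset_of_ncard_le hvw h.ge)
      · exact (hinj (Set.eq_of_subset_of_ncard_le hvw h.le)).symm
    rw [M.det_eq_prod_diag_of_injective hb fun v w hvw => ?_]
    · exact Finset.prod_congr rfl fun v _ => by
        rw [show M v v = _ from ePhi_signedFilter hs (F v) v, if_pos (hmin v)]
    · rw [show M v w = _ from ePhi_signedFilter hs (F v) w, if_neg fun h => ?_]
      exact hvw.not_ge (Set.ncard_le_ncard (hmono v w h.1))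
  have habs : |M.det| = 1 := by
    rw [hdet, Finset.abs_prod]
    exact Finset.prod_eq_one fun v _ => by rcases hs v with h | h <;> simp [h]
  constructor
  · have hlin : LinearIndependent ℝ fun v => M v :=
      Matrix.linearIndependent_rows_of_det_ne_zero fun h => by simp [h] at habs
    have h₀ : signedFilter s ∅ ∈ K := hKeq ▸ Set.mem_insert _ _
    have hFK : ∀ v, signedFilter s (F v) ∈ K := fun v => hKeq ▸ Or.inr ⟨v, rfl⟩
    have hsinj : Function.Injective (signedFilter s) :=
      Function.LeftInverse.injective (g := zsupp) (zsupp_signedFilter hs)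
    rw [affineIndependent_iff_linearIndependent_vsub ℝ _ (⟨_, h₀⟩ : K)]
    let φ : P → {x : K // x ≠ ⟨_, h₀⟩} := fun v => ⟨⟨_, hFK v⟩, fun h => by
      have : F v = ∅ := hsinj (congrArg Subtype.val h)
      exact Set.notMem_empty v (this ▸ (hmin v).1)⟩
    have hφ : Function.Bijective φ := by
      constructor
      · intro v w h
        exact hinj (hsinj (congrArg (fun x => x.1.1) h))
      · rintro ⟨⟨f, hf⟩, hne⟩
        have hf' := hf
        rw [hKeq] at hf'
        rcases hf' with rfl | ⟨v, rfl⟩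
        · exact absurd rfl hne
        · exact ⟨v, rfl⟩
    rw [← linearIndependent_equiv (Equiv.ofBijective φ hφ)]
    have hcomp : (fun x : {x : K // x ≠ ⟨_, h₀⟩} => ePhi (x.1 : P → ℤ) -ᵥ
        ePhi (signedFilter s ∅)) ∘ Equiv.ofBijective φ hφ = fun v => M v := by
      ext v w
      simp [φ, hzero, M]
    exact hcomp ▸ hlin
  · have himage : ePhi '' K = insert 0 (Set.range fun v => M v) := by
      rw [hKeq, Set.image_insert_eq, ← Set.range_comp, hzero]
      rfl
    rw [Tsimp, himage, volume_convexHull_insert_zero_rows, habs, ENNReal.ofReal_one, one_mul]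
end
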